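/- arXiv:2212.09319 — 7 statements merged into one kernel-verified Lean document; each statement's English description precedes it below -/
import Mathlib

section
/- Let d ≥ 1 and let {E_i}_{i∈I} be a finite family of d×d complex matrices satisfying Σ_i E_i† E_i ⪯ I_d (trace-nonincreasing channel condition, where ⪯ is the Loewner order). Then the unitarity u(E) := (1/d²) Σ_{i,j∈I} |tr(E_i† E_j)|² satisfies u(E) ≤ 1. -/
open Matrix
open scoped ComplexOrder

/-- The squared Frobenius norm of a complex matrix, as the sum of the squared norms of its
entries. -/
theorem Matrix.re_trace_conjTranspose_mul_self {m n : Type*} [Fintype m] [Fintype n]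
    (A : Matrix m n ℂ) : (Aᴴ * A).trace.re = ∑ p : n × m, ‖A p.2 p.1‖ ^ 2 := by
  simp only [Matrix.trace, Matrix.diag_apply, Matrix.mul_apply, Matrix.conjTranspose_apply,
    Fintype.sum_prod_type, Complex.re_sum, RCLike.star_def, ← Complex.normSq_eq_conj_mul_self,
    Complex.ofReal_re, Complex.normSq_eq_norm_sq]

/-- The Cauchy–Schwarz inequality for the Frobenius inner product. -/
theorem Matrix.normSq_trace_conjTranspose_mul_le {m n : Type*} [Fintype m] [Fintype n]
    (A B : Matrix m n ℂ) :
    Complex.normSq (Aᴴ * B).trace ≤ (Aᴴ * A).trace.re * (Bᴴ * B).trace.re := by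
  have h : ‖(Aᴴ * B).trace‖ ≤ ∑ p : n × m, ‖A p.2 p.1‖ * ‖B p.2 p.1‖ := by
    have htrace : (Aᴴ * B).trace = ∑ p : n × m, star (A p.2 p.1) * B p.2 p.1 := by
      simp only [Matrix.trace, Matrix.diag_apply, Matrix.mul_apply, Matrix.conjTranspose_apply,
        Fintype.sum_prod_type]
    rw [htrace]
    refine (norm_sum_le _ _).trans_eq ?_
    simp only [norm_mul, norm_star]
  rw [Complex.normSq_eq_norm_sq, Matrix.re_trace_conjTranspose_mul_self,
    Matrix.re_trace_conjTranspose_mul_self]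
  calc ‖(Aᴴ * B).trace‖ ^ 2 ≤ (∑ p : n × m, ‖A p.2 p.1‖ * ‖B p.2 p.1‖) ^ 2 := by gcongr
    _ ≤ _ := Finset.sum_mul_sq_le_sq_mul_sq _ _ _

/-- If the Kraus operators satisfy the trace-nonincreasing condition
`Σ_i E_i† E_i ⪯ I`, then the unitarity `u(E) = (1/d²) Σ_{i,j} |tr(E_i† E_j)|²` is at most 1. -/
theorem unitarity_le_one (d : ℕ) (hd : 1 ≤ d) (ι : Type*) [Fintype ι]
    (E : ι → Matrix (Fin d) (Fin d) ℂ)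
    (hE : ((1 : Matrix (Fin d) (Fin d) ℂ) - ∑ i, (E i)ᴴ * E i).PosSemidef) :
    (1 / (d : ℝ) ^ 2) * ∑ i, ∑ j,
        Complex.normSq (Matrix.trace ((E i)ᴴ * E j)) ≤ 1 := by
  have hsum : ∑ i, ((E i)ᴴ * E i).trace.re ≤ d := by
    have h := (Complex.le_def.mp hE.trace_nonneg).1
    simpa [Matrix.trace_sub, Matrix.trace_sum] using h
  have hnonneg : 0 ≤ ∑ i, ((E i)ᴴ * E i).trace.re :=
    Finset.sum_nonneg fun i _ ↦ by
      rw [Matrix.re_trace_conjTranspose_mul_self]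
      positivity
  have hd' : (0 : ℝ) < (d : ℝ) ^ 2 := by
    have : (0 : ℝ) < d := by exact_mod_cast hd
    positivity
  rw [one_div_mul_eq_div, div_le_one hd']
  calc ∑ i, ∑ j, Complex.normSq (Matrix.trace ((E i)ᴴ * E j))
      ≤ ∑ i, ∑ j, ((E i)ᴴ * E i).trace.re * ((E j)ᴴ * E j).trace.re := by
        gcongr with i _ j _
        exact Matrix.normSq_trace_conjTranspose_mul_le (E i) (E j)
    _ = (∑ i, ((E i)ᴴ * E i).trace.re) ^ 2 := by rw [sq, Finset.sum_mul_sum]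
    _ ≤ (d : ℝ) ^ 2 := by gcongr
end

section
/- Let d, T ≥ 1 and suppose 2·d^T > d(d+1)⋯(d+T−1). Let G be the S_T × S_T Gram matrix with entries G_{π,σ} = tr(P_π† P_σ), where P_π is the permutation operator on (ℂ^d)^{⊗T}. Then G is positive definite (in particular, invertible, so the operators {P_π : π ∈ S_T} are linearly independent). -/
open Matrix
open scoped ComplexOrder

/-- The rising product of `T > d` factors starting at `d` is at least `2 * d ^ T`. -/
theorem two_mul_pow_le_prod_range_add {d T : ℕ} (h : d < T) :
    2 * d ^ T ≤ ∏ t ∈ Finset.range T, (d + t) := by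
  have hmem : d ∈ Finset.range T := Finset.mem_range.2 h
  have hle : d ^ (T - 1) ≤ ∏ t ∈ (Finset.range T).erase d, (d + t) := by
    have := Finset.pow_card_le_prod ((Finset.range T).erase d) (fun t => d + t) d
      fun t _ => Nat.le_add_right d t
    rwa [Finset.card_erase_of_mem hmem, Finset.card_range] at this
  rw [← Finset.mul_prod_erase _ _ hmem]
  calc 2 * d ^ T = (d + d) * d ^ (T - 1) := by
        rw [← two_mul, mul_assoc, ← pow_succ', Nat.sub_add_cancel (by omega)]
    _ ≤ _ := Nat.mul_le_mul_left _ hle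

/-- If `2·d^T > d(d+1)⋯(d+T−1)`, then the Gram matrix
`G_{π,σ} = tr(P_π† P_σ)` of the permutation operators on `(ℂ^d)^{⊗T}` is positive
definite (in particular invertible, so the `P_π` are linearly independent). -/
theorem gram_matrix_posDef (d T : ℕ) (hd : 1 ≤ d) (hT : 1 ≤ T)
    (hdT : 2 * d ^ T > ∏ t ∈ Finset.range T, (d + t))
    (P : Equiv.Perm (Fin T) → Matrix (Fin T → Fin d) (Fin T → Fin d) ℂ)
    (hP : P = fun (π : Equiv.Perm (Fin T)) =>
      Matrix.of fun f g => if f = g ∘ ⇑π⁻¹ then (1 : ℂ) else 0)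
    (G : Matrix (Equiv.Perm (Fin T)) (Equiv.Perm (Fin T)) ℂ)
    (hG : G = Matrix.of fun π σ => Matrix.trace ((P π)ᴴ * P σ)) :
    G.PosDef := by
  have hTd : T ≤ d := by
    by_contra! h
    exact absurd (two_mul_pow_le_prod_range_add h) (not_le.2 hdT)
  let B : Matrix ((Fin T → Fin d) × (Fin T → Fin d)) (Equiv.Perm (Fin T)) ℂ :=
    Matrix.of fun p π => P π p.1 p.2
  have hGB : G = Bᴴ * B := by
    ext π σ
    simp only [hG, B, Matrix.of_apply, Matrix.trace, Matrix.diag_apply, Matrix.mul_apply,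
      Matrix.conjTranspose_apply, Fintype.sum_prod_type]
    exact Finset.sum_comm
  rw [hGB]
  refine Matrix.PosDef.conjTranspose_mul_self B fun x y hxy => funext fun π => ?_
  have hB : ∀ z, (B *ᵥ z) (Fin.castLE hTd ∘ ⇑π⁻¹, Fin.castLE hTd) = z π := by
    intro z
    rw [Matrix.mulVec, dotProduct, Finset.sum_eq_single π]
    · simp [B, hP]
    · intro σ _ hσ
      have hne : Fin.castLE hTd ∘ ⇑π⁻¹ ≠ Fin.castLE hTd ∘ ⇑σ⁻¹ := fun h =>
        hσ (inv_injective (DFunLike.coe_injective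
          ((Fin.castLE_injective hTd).comp_left h))).symm
      simp only [B, hP, Matrix.of_apply, if_neg hne, zero_mul]
    · simp
  rw [← hB x, ← hB y, hxy]
end

section
/- Let d, T ≥ 1 and let G be the S_T × S_T Gram matrix with entries G_{π,σ} = tr(P_π† P_σ), where P_π is the permutation operator on (ℂ^d)^{⊗T}. Then every eigenvalue λ of G satisfies λ ≤ d(d+1)⋯(d+T−1) = ∏_{t=0}^{T−1}(d+t). -/
open Matrix

theorem exists_perm_comp_eq_of_map_univ_eq {ι α : Type*} [Fintype ι] (f g : ι → α)
    (h : Finset.univ.val.map f = Finset.univ.val.map g) :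
    ∃ σ : Equiv.Perm ι, f ∘ σ = g := by
  classical
  have hcard (a : α) : Fintype.card {i // g i = a} = Fintype.card {i // f i = a} := by
    have := congrArg (Multiset.count a) h
    simp only [Multiset.count_map, eq_comm (a := a)] at this
    rw [Fintype.card_subtype, Fintype.card_subtype]
    exact this.symm
  exact ⟨Equiv.ofFiberEquiv fun a => Fintype.equivOfCardEq (hcard a),
    funext fun i => Equiv.ofFiberEquiv_map _ i⟩

/-- There are at most as many orbits of functions `ι → α` under permutation of `ι` as there are
multisets of size `card ι` in `α`. -/
theorem card_orbits_domMulAct_perm_le (ι α : Type*) [Fintype ι] [Fintype α] :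
    Nat.card (MulAction.orbitRel.Quotient (Equiv.Perm ι)ᵈᵐᵃ (ι → α)) ≤
      (Fintype.card α).multichoose (Fintype.card ι) := by
  classical
  rw [← Sym.card_sym_eq_multichoose, ← Nat.card_eq_fintype_card]
  let toSym (f : ι → α) : Sym α (Fintype.card ι) :=
    ⟨Finset.univ.val.map f, by simp [Finset.card_univ]⟩
  have hinv (f g : ι → α) (h : MulAction.orbitRel (Equiv.Perm ι)ᵈᵐᵃ (ι → α) f g) :
      toSym f = toSym g := by
    obtain ⟨c, rfl⟩ := h
    apply Subtype.ext
    change Finset.univ.val.map (g ∘ (DomMulAct.mk.symm c : Equiv.Perm ι)) = Finset.univ.val.map g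
    rw [← Multiset.map_map, Multiset.map_univ_val_equiv]
  refine Nat.card_le_card_of_injective (Quotient.lift toSym hinv) ?_
  rintro ⟨f⟩ ⟨g⟩ h
  obtain ⟨σ, hσ⟩ := exists_perm_comp_eq_of_map_univ_eq g f (congrArg Subtype.val h).symm
  exact Quotient.sound ⟨DomMulAct.mk σ, hσ⟩

theorem sum_card_comp_perm_eq_self_le (ι α : Type*) [Fintype ι] [DecidableEq ι] [Fintype α]
    [DecidableEq α] :
    ∑ σ : Equiv.Perm ι, Fintype.card {f : ι → α // f ∘ σ = f} ≤
      (Fintype.card α).ascFactorial (Fintype.card ι) := by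
  classical
  let : Fintype (Equiv.Perm ι)ᵈᵐᵃ := Fintype.ofEquiv _ DomMulAct.mk
  have burnside := MulAction.sum_card_fixedBy_eq_card_orbits_mul_card_group
    (Equiv.Perm ι)ᵈᵐᵃ (ι → α)
  rw [← Nat.card_eq_fintype_card (α := MulAction.orbitRel.Quotient _ _),
    ← Fintype.card_congr DomMulAct.mk, Fintype.card_perm] at burnside
  have hsum : ∑ σ : Equiv.Perm ι, Fintype.card {f : ι → α // f ∘ σ = f} =
      ∑ c : (Equiv.Perm ι)ᵈᵐᵃ, Fintype.card (MulAction.fixedBy (ι → α) c) :=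
    Fintype.sum_equiv DomMulAct.mk _ _ fun σ => Fintype.card_congr (Equiv.refl _)
  rw [hsum, burnside, Nat.ascFactorial_eq_factorial_mul_choose', ← Nat.multichoose_eq, mul_comm]
  exact Nat.mul_le_mul_left _ (card_orbits_domMulAct_perm_le ι α)

/-- The eigenvalues of a Hermitian matrix are bounded by its largest absolute row sum. -/
theorem Matrix.IsHermitian.eigenvalues_le_of_sum_norm_le {n 𝕜 : Type*} [Fintype n] [DecidableEq n]
    [RCLike 𝕜] {A : Matrix n n 𝕜} (hA : A.IsHermitian) {c : ℝ}
    (hc : ∀ i, ∑ j, ‖A i j‖ ≤ c) (i : n) : hA.eigenvalues i ≤ c := by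
  have hev : Module.End.HasEigenvalue (Matrix.toLin' A) (hA.eigenvalues i : 𝕜) := by
    rw [Module.End.hasEigenvalue_iff_mem_spectrum, Matrix.spectrum_toLin']
    exact spectrum.algebraMap_mem 𝕜 (hA.eigenvalues_mem_spectrum_real i)
  obtain ⟨k, hk⟩ := eigenvalue_mem_ball hev
  rw [mem_closedBall_iff_norm] at hk
  calc hA.eigenvalues i ≤ ‖(hA.eigenvalues i : 𝕜)‖ := by
        rw [RCLike.norm_ofReal]; exact le_abs_self _
    _ ≤ ‖A k k‖ + ∑ j ∈ Finset.univ.erase k, ‖A k j‖ :=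
        (norm_le_norm_add_norm_sub' _ (A k k)).trans (by gcongr)
    _ = ∑ j, ‖A k j‖ := Finset.add_sum_erase _ (fun j => ‖A k j‖) (Finset.mem_univ k)
    _ ≤ c := hc k

theorem trace_conjTranspose_mul_permutation {ι α : Type*} [Fintype ι] [DecidableEq ι] [Fintype α]
    [DecidableEq α] (π σ : Equiv.Perm ι) :
    Matrix.trace ((Matrix.of fun f g : ι → α => if f = g ∘ ⇑π⁻¹ then (1 : ℂ) else 0)ᴴ *
      Matrix.of fun f g : ι → α => if f = g ∘ ⇑σ⁻¹ then (1 : ℂ) else 0) =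
      Fintype.card {f : ι → α // f ∘ ⇑(π⁻¹ * σ) = f} := by
  have hiff (g : ι → α) : g ∘ ⇑σ⁻¹ = g ∘ ⇑π⁻¹ ↔ g ∘ ⇑(π⁻¹ * σ) = g := by
    constructor
    · intro h
      funext x
      simpa using (congrFun h (σ x)).symm
    · intro h
      funext x
      simpa using (congrFun h (σ⁻¹ x)).symm
  simp_rw [← hiff, Fintype.card_subtype]
  simp [Matrix.trace, Matrix.mul_apply, apply_ite]

open Matrix

/-- Every eigenvalue of the Gram matrix `G_{π,σ} = tr(P_π† P_σ)` of the
permutation operators on `(ℂ^d)^{⊗T}` is at most `d(d+1)⋯(d+T−1)` (the Gram matrix is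
Hermitian, so its eigenvalues are real). -/
theorem gram_matrix_eigenvalues_le (d T : ℕ) (hd : 1 ≤ d) (hT : 1 ≤ T)
    (P : Equiv.Perm (Fin T) → Matrix (Fin T → Fin d) (Fin T → Fin d) ℂ)
    (hP : P = fun (π : Equiv.Perm (Fin T)) =>
      Matrix.of fun f g => if f = g ∘ ⇑π⁻¹ then (1 : ℂ) else 0)
    (G : Matrix (Equiv.Perm (Fin T)) (Equiv.Perm (Fin T)) ℂ)
    (hG : G = Matrix.of fun π σ => Matrix.trace ((P π)ᴴ * P σ))
    (hHerm : G.IsHermitian) :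
    ∀ i, hHerm.eigenvalues i ≤ ∏ t ∈ Finset.range T, ((d : ℝ) + (t : ℝ)) := by
  refine hHerm.eigenvalues_le_of_sum_norm_le fun π => ?_
  have hrow : ∑ σ, ‖G π σ‖ =
      ((∑ σ : Equiv.Perm (Fin T), Fintype.card {f : Fin T → Fin d // f ∘ σ = f} : ℕ) : ℝ) := by
    rw [Nat.cast_sum]
    refine Fintype.sum_equiv (Equiv.mulLeft π⁻¹) _ _ fun σ => ?_
    simp only [hG, hP, Matrix.of_apply]
    rw [trace_conjTranspose_mul_permutation, Complex.norm_natCast]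
    rfl
  rw [hrow]
  have hle := sum_card_comp_perm_eq_self_le (Fin T) (Fin d)
  rw [Fintype.card_fin, Fintype.card_fin, Nat.ascFactorial_eq_prod_range] at hle
  exact_mod_cast hle
end

section
/- Let d, T ≥ 1, let G be the S_T × S_T Gram matrix with entries G_{π,σ} = tr(P_π† P_σ), and let λ ∈ ℂ. Suppose x, y : S_T → ℂ satisfy Gx = λx and Gy = λy. Define z : S_T → ℂ by z_π = Σ_{σ ∈ S_T} x_{πσ⁻¹} · y_σ. Then Gz = λz, and moreover γ(z) = γ(x)·γ(y), where γ(x) := Σ_{π ∈ S_T} x_π P_π. -/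
open Matrix

section TensorPerm

variable {ι κ R : Type*} [Fintype ι] [DecidableEq κ]

/-- The operator permuting the tensor factors of `R^κ ⊗ ⋯ ⊗ R^κ` (indexed by `ι`) by `π`. -/
def tensorPerm (κ R : Type*) [DecidableEq κ] [Zero R] [One R] (π : Equiv.Perm ι) :
    Matrix (ι → κ) (ι → κ) R :=
  Matrix.of fun f g => if f = g ∘ ⇑π⁻¹ then 1 else 0

theorem tensorPerm_mul [DecidableEq ι] [Fintype κ] [NonAssocSemiring R] (π σ : Equiv.Perm ι) :
    tensorPerm κ R π * tensorPerm κ R σ = tensorPerm κ R (π * σ) := by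
  ext f g
  simp [tensorPerm, Matrix.mul_apply, Function.comp_assoc]

theorem conjTranspose_tensorPerm [CommSemiring R] [StarRing R] (π : Equiv.Perm ι) :
    (tensorPerm κ R π)ᴴ = tensorPerm κ R π⁻¹ := by
  ext f g
  have h : g = f ∘ ⇑π⁻¹ ↔ f = g ∘ ⇑π :=
    ⟨fun h => by simp [h, funext_iff], fun h => by simp [h, funext_iff]⟩
  simp only [tensorPerm, Matrix.conjTranspose_apply, Matrix.of_apply, h, inv_inv,
    apply_ite (star : R → R), star_one, star_zero]

end TensorPerm

section Convolution

variable {Γ R : Type*} [Group Γ] [Fintype Γ] [CommSemiring R]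

/-- Convolution by `y` on the right preserves the eigenspaces of convolution by a class function,
written here as a kernel `t (π⁻¹ * τ)` with `t (a * b) = t (b * a)`. -/
theorem sum_classFunction_mul_convolution (t : Γ → R) (ht : ∀ a b, t (a * b) = t (b * a))
    (c : R) (x y : Γ → R) (hx : ∀ π, ∑ τ, t (π⁻¹ * τ) * x τ = c * x π) (π : Γ) :
    ∑ τ, t (π⁻¹ * τ) * ∑ σ, x (τ * σ⁻¹) * y σ = c * ∑ σ, x (π * σ⁻¹) * y σ := by
  simp_rw [Finset.mul_sum]
  rw [Finset.sum_comm]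
  refine Finset.sum_congr rfl fun σ _ => ?_
  rw [← mul_assoc, ← hx (π * σ⁻¹), Finset.sum_mul]
  refine Fintype.sum_equiv (Equiv.mulRight σ⁻¹) _ _ fun τ => ?_
  have h : t ((π * σ⁻¹)⁻¹ * (τ * σ⁻¹)) = t (π⁻¹ * τ) := by
    rw [_root_.mul_inv_rev, inv_inv, mul_assoc, ht, ← mul_assoc, inv_mul_cancel_right]
  rw [Equiv.coe_mulRight, h, mul_assoc]

/-- A multiplicative family of elements of an algebra turns convolution into multiplication. -/
theorem sum_convolution_smul {A : Type*} [Semiring A] [Algebra R A] (p : Γ → A)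
    (hp : ∀ a b, p a * p b = p (a * b)) (x y : Γ → R) :
    ∑ π, (∑ σ, x (π * σ⁻¹) * y σ) • p π = (∑ π, x π • p π) * ∑ π, y π • p π := by
  simp_rw [Finset.sum_mul_sum, Finset.sum_smul]
  rw [Finset.sum_comm, Finset.sum_comm (s := Finset.univ) (t := Finset.univ)
    (f := fun i j => x i • p i * y j • p j)]
  refine Finset.sum_congr rfl fun σ _ => ?_
  refine Fintype.sum_equiv (Equiv.mulRight σ⁻¹) _ _ fun τ => ?_
  simp [hp, smul_smul, mul_comm]

end Convolution

/-- Eigenspaces of the Gram matrix `G` of permutation operators are closed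
under the convolution product: if `Gx = λx` and `Gy = λy`, then the convolution
`z_π = Σ_σ x_{πσ⁻¹} y_σ` satisfies `Gz = λz`, and `γ(z) = γ(x)·γ(y)` where
`γ(x) = Σ_π x_π P_π`. -/
theorem gram_eigenspace_mul_closed (d T : ℕ) (hd : 1 ≤ d) (hT : 1 ≤ T)
    (P : Equiv.Perm (Fin T) → Matrix (Fin T → Fin d) (Fin T → Fin d) ℂ)
    (hP : P = fun (π : Equiv.Perm (Fin T)) =>
      Matrix.of fun f g => if f = g ∘ ⇑π⁻¹ then (1 : ℂ) else 0)
    (G : Matrix (Equiv.Perm (Fin T)) (Equiv.Perm (Fin T)) ℂ)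
    (hG : G = Matrix.of fun π σ => Matrix.trace ((P π)ᴴ * P σ))
    (lam : ℂ) (x y : Equiv.Perm (Fin T) → ℂ)
    (hx : G.mulVec x = lam • x) (hy : G.mulVec y = lam • y)
    (z : Equiv.Perm (Fin T) → ℂ)
    (hz : z = fun π => ∑ σ : Equiv.Perm (Fin T), x (π * σ⁻¹) * y σ) :
    G.mulVec z = lam • z ∧
      (∑ π : Equiv.Perm (Fin T), z π • P π)
        = (∑ π : Equiv.Perm (Fin T), x π • P π) * (∑ π : Equiv.Perm (Fin T), y π • P π) := by
  replace hP : P = tensorPerm (Fin d) ℂ := hP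
  subst hP hz
  refine ⟨?_, sum_convolution_smul _ tensorPerm_mul x y⟩
  have hGv (v : Equiv.Perm (Fin T) → ℂ) (π : Equiv.Perm (Fin T)) :
      G.mulVec v π = ∑ τ, (tensorPerm (Fin d) ℂ (π⁻¹ * τ)).trace * v τ := by
    simp only [hG, Matrix.mulVec, dotProduct, Matrix.of_apply, conjTranspose_tensorPerm,
      tensorPerm_mul]
  ext π
  rw [hGv]
  refine sum_classFunction_mul_convolution (fun ρ => (tensorPerm (Fin d) ℂ ρ).trace)
    (fun a b => ?_) lam x y (fun ρ => ?_) π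
  · rw [← tensorPerm_mul, Matrix.trace_mul_comm, tensorPerm_mul]
  · rw [← hGv, hx]
    rfl
end

section
/- Let n ≥ 1 and let A be a linear subspace of the n×n complex matrices that is closed under matrix multiplication and under conjugate transpose (a *-subalgebra of M_n(ℂ), not necessarily unital). Let {X_k}_{k=1}^m be any basis of A that is orthonormal with respect to the Hilbert–Schmidt inner product ⟨X, Y⟩ = tr(X†Y). Then the n²×n² matrix Σ_{k=1}^m X_k ⊗ X_k^* is positive semidefinite, where ⊗ denotes the Kronecker product and X^* denotes the entrywise complex conjugate of X. -/
open Matrix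
open scoped Kronecker ComplexOrder

/-- Expansion of a matrix in the span of a Hilbert–Schmidt-orthonormal family. -/
lemma eq_sum_trace_smul_of_mem_span {ι κ : Type*} [Fintype ι] [Fintype κ]
    [DecidableEq κ] {X : κ → Matrix ι ι ℂ}
    (horth : ∀ k l, Matrix.trace ((X k)ᴴ * X l) = if k = l then (1 : ℂ) else 0)
    {Y : Matrix ι ι ℂ} (hY : Y ∈ Submodule.span ℂ (Set.range X)) :
    Y = ∑ l, Matrix.trace ((X l)ᴴ * Y) • X l := by
  induction hY using Submodule.span_induction with
  | mem Y h =>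
    obtain ⟨k, rfl⟩ := h
    simp [horth]
  | zero => simp
  | add Y Z _ _ hY hZ =>
    simp only [Matrix.mul_add, Matrix.trace_add, add_smul, Finset.sum_add_distrib]
    rw [← hY, ← hZ]
  | smul a Y _ hY =>
    simp only [Matrix.mul_smul, Matrix.trace_smul, smul_assoc, ← Finset.smul_sum]
    rw [← hY]

/-- Transfer of coefficients between the two legs of a sum of matrices `Y k ⊗ conj (Z k)`. -/
lemma sum_kronecker_map_conj_transfer {ι κ : Type*} [Fintype κ]
    {X Y Z W : κ → Matrix ι ι ℂ} (a : κ → κ → ℂ)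
    (hY : ∀ k, Y k = ∑ l, a l k • X l)
    (hW : ∀ l, W l = ∑ k, starRingEnd ℂ (a l k) • Z k) :
    ∑ k, Y k ⊗ₖ (Z k).map (starRingEnd ℂ) = ∑ l, X l ⊗ₖ (W l).map (starRingEnd ℂ) := by
  ext ⟨i, i'⟩ ⟨j, j'⟩
  simp only [Matrix.sum_apply, Matrix.kroneckerMap_apply, Matrix.map_apply, hY, hW,
    Matrix.smul_apply, smul_eq_mul, map_sum, map_mul, Complex.conj_conj, Finset.sum_mul,
    Finset.mul_sum]
  rw [Finset.sum_comm]
  refine Finset.sum_congr rfl fun l _ => Finset.sum_congr rfl fun k _ => ?_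
  ring

lemma star_trace_conjTranspose_mul {ι : Type*} [Fintype ι] (P Q : Matrix ι ι ℂ) :
    starRingEnd ℂ (Matrix.trace (Pᴴ * Q)) = Matrix.trace (Qᴴ * P) := by
  rw [starRingEnd_apply, ← Matrix.trace_conjTranspose, Matrix.conjTranspose_mul,
    Matrix.conjTranspose_conjTranspose]

/-- A Hermitian matrix `M` with `M * M = D * M` for a positive semidefinite `D` is positive
semidefinite. -/
lemma Matrix.IsHermitian.posSemidef_of_mul_self_eq {ι : Type*} [Fintype ι] [DecidableEq ι]
    {M D : Matrix ι ι ℂ}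
    (hM : M.IsHermitian) (hD : D.PosSemidef) (h : M * M = D * M) : M.PosSemidef := by
  rw [hM.posSemidef_iff_eigenvalues_nonneg]
  intro i
  by_contra! hneg
  simp only [Pi.zero_apply] at hneg
  set r : ℝ := hM.eigenvalues i
  set v : ι → ℂ := ⇑(hM.eigenvectorBasis i)
  have hMv : M *ᵥ v = (r : ℂ) • v := by
    simpa using hM.mulVec_eigenvectorBasis i
  have hr : (r : ℂ) ≠ 0 := by exact_mod_cast hneg.ne
  have hDv : D *ᵥ v = (r : ℂ) • v := by
    have h2 : M *ᵥ (M *ᵥ v) = D *ᵥ (M *ᵥ v) := by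
      simp only [Matrix.mulVec_mulVec, h]
    rw [hMv, Matrix.mulVec_smul, Matrix.mulVec_smul, hMv] at h2
    exact (smul_right_injective _ hr h2).symm
  have hv0 : v ≠ 0 := by
    intro h0
    apply hM.eigenvectorBasis.orthonormal.ne_zero i
    ext j
    exact congrFun h0 j
  have hnn := hD.dotProduct_mulVec_nonneg v
  rw [hDv, dotProduct_smul, smul_eq_mul] at hnn
  have hpos : 0 < star v ⬝ᵥ v := Matrix.dotProduct_star_self_pos_iff.mpr hv0
  have hlt : (r : ℂ) * (star v ⬝ᵥ v) < 0 :=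
    mul_neg_of_neg_of_pos (by exact_mod_cast hneg) hpos
  exact absurd hnn hlt.not_ge

/-- If `{X_k}` is a Hilbert–Schmidt-orthonormal basis of a (not
necessarily unital) *-subalgebra of `M_n(ℂ)`, then `Σ_k X_k ⊗ X_k^*` is positive
semidefinite, where `X^*` denotes the entrywise complex conjugate. -/
theorem star_subalgebra_orthonormal_basis_kronecker_posSemidef
    (n : ℕ) (hn : 1 ≤ n)
    (A : Submodule ℂ (Matrix (Fin n) (Fin n) ℂ))
    (hmul : ∀ X Y, X ∈ A → Y ∈ A → X * Y ∈ A)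
    (hstar : ∀ X, X ∈ A → Xᴴ ∈ A)
    (m : ℕ) (X : Fin m → Matrix (Fin n) (Fin n) ℂ)
    (hmem : ∀ k, X k ∈ A)
    (hspan : Submodule.span ℂ (Set.range X) = A)
    (horth : ∀ k l, Matrix.trace ((X k)ᴴ * X l) = if k = l then (1 : ℂ) else 0) :
    (∑ k, X k ⊗ₖ (X k).map (starRingEnd ℂ)).PosSemidef := by
  have hexp : ∀ Y ∈ A, Y = ∑ l, Matrix.trace ((X l)ᴴ * Y) • X l := fun Y hY =>
    eq_sum_trace_smul_of_mem_span horth (hspan ▸ hY)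
  have hconj (P Q : Matrix (Fin n) (Fin n) ℂ) :
      (P * Q).map (starRingEnd ℂ) = P.map (starRingEnd ℂ) * Q.map (starRingEnd ℂ) :=
    Matrix.map_mul
  have hherm : (∑ k, X k ⊗ₖ (X k).map (starRingEnd ℂ)).IsHermitian := by
    have hadj : (∑ k, X k ⊗ₖ (X k).map (starRingEnd ℂ))ᴴ =
        ∑ k, (X k)ᴴ ⊗ₖ ((X k)ᴴ).map (starRingEnd ℂ) := by
      rw [Matrix.conjTranspose_sum]
      refine Finset.sum_congr rfl fun k _ => ?_
      rw [Matrix.conjTranspose_kronecker]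
      rfl
    rw [Matrix.IsHermitian, hadj]
    refine sum_kronecker_map_conj_transfer (fun l k => Matrix.trace ((X l)ᴴ * (X k)ᴴ))
      (fun k => hexp _ (hstar _ (hmem k))) fun l => ?_
    have h := congrArg Matrix.conjTranspose (hexp _ (hstar _ (hmem l)))
    rw [Matrix.conjTranspose_conjTranspose, Matrix.conjTranspose_sum] at h
    simpa only [Matrix.conjTranspose_smul, starRingEnd_apply,
      Matrix.trace_mul_comm (X _)ᴴ (X l)ᴴ] using h
  have hleft (k : Fin m) : ∑ l, (X k * X l) ⊗ₖ (X l).map (starRingEnd ℂ) =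
      ∑ l, X l ⊗ₖ ((X k)ᴴ * X l).map (starRingEnd ℂ) := by
    refine sum_kronecker_map_conj_transfer (fun l p => Matrix.trace ((X l)ᴴ * (X k * X p)))
      (fun p => hexp _ (hmul _ _ (hmem k) (hmem p))) fun l => ?_
    refine (hexp _ (hmul _ _ (hstar _ (hmem k)) (hmem l))).trans ?_
    refine Finset.sum_congr rfl fun p _ => ?_
    rw [star_trace_conjTranspose_mul, Matrix.conjTranspose_mul, Matrix.mul_assoc]
  let B (k : Fin m) : Matrix (Fin n × Fin n) (Fin n × Fin n) ℂ :=
    (1 : Matrix (Fin n) (Fin n) ℂ) ⊗ₖ (X k).map (starRingEnd ℂ)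
  have hB (k : Fin m) : (B k)ᴴ =
      (1 : Matrix (Fin n) (Fin n) ℂ) ⊗ₖ ((X k)ᴴ).map (starRingEnd ℂ) := by
    simp only [B, Matrix.conjTranspose_kronecker, Matrix.conjTranspose_one]
    rfl
  refine hherm.posSemidef_of_mul_self_eq (D := ∑ k, B k * (B k)ᴴ)
    (Matrix.posSemidef_sum _ fun k _ => Matrix.posSemidef_self_mul_conjTranspose _) ?_
  rw [Finset.sum_mul, Finset.sum_mul]
  refine Finset.sum_congr rfl fun k _ => ?_
  calc X k ⊗ₖ (X k).map (starRingEnd ℂ) * ∑ l, X l ⊗ₖ (X l).map (starRingEnd ℂ)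
      = B k * ∑ l, (X k * X l) ⊗ₖ (X l).map (starRingEnd ℂ) := by
        simp only [B, Finset.mul_sum, ← Matrix.mul_kronecker_mul, Matrix.one_mul]
    _ = B k * (B k)ᴴ * ∑ l, X l ⊗ₖ (X l).map (starRingEnd ℂ) := by
        rw [hleft, Matrix.mul_assoc, hB]
        simp only [Finset.mul_sum, ← Matrix.mul_kronecker_mul, Matrix.one_mul, hconj]
end

section
/- For every real number ε with 0 ≤ ε ≤ 1/3, it holds that √( (2/3)·(2/3 + ε) ) + √( (1/3)·(1/3 − ε) ) ≥ 1 − 2ε². -/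
/-- For `0 ≤ ε ≤ 1/3`,
`√((2/3)(2/3+ε)) + √((1/3)(1/3−ε)) ≥ 1 − 2ε²`
(the fidelity between the Jamiołkowski states of the two candidate channels). -/
theorem fidelity_lower_bound (ε : ℝ) (h0 : 0 ≤ ε) (h1 : ε ≤ 1 / 3) :
    Real.sqrt ((2 / 3) * (2 / 3 + ε)) + Real.sqrt ((1 / 3) * (1 / 3 - ε))
      ≥ 1 - 2 * ε ^ 2 := by
  have h₁ : 2 / 3 + ε / 2 - 3 / 16 * ε ^ 2 ≤ Real.sqrt ((2 / 3) * (2 / 3 + ε)) := by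
    apply Real.le_sqrt_of_sq_le
    have h : 0 ≤ ε ^ 3 * (3 / 16 - 9 / 256 * ε) :=
      mul_nonneg (pow_nonneg h0 3) (by linarith)
    linarith
  have h₂ : (1 / 3) * ((1 - 3 * ε) * (1 + 3 / 2 * ε)) ≤
      Real.sqrt ((1 / 3) * (1 / 3 - ε)) := by
    apply Real.le_sqrt_of_sq_le
    have h : 0 ≤ (1 - 3 * ε) * (ε ^ 2 * (27 / 4 + 27 / 4 * ε)) :=
      mul_nonneg (by linarith) (by positivity)
    linarith
  linarith [sq_nonneg ε]
end

section
/- Let d ≥ 1, let μ be the Haar probability measure on the unitary group U(d), and let A, B be arbitrary d×d complex matrices. Then ∫_{U(d)} ⟨0| U† A U |0⟩ · ⟨0| U† B U |0⟩ dμ(U) = ( tr(A)·tr(B) + tr(AB) ) / ( d(d+1) ). -/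
open Matrix MeasureTheory

namespace Matrix.unitaryGroup

variable {n : Type*} [Fintype n] [DecidableEq n]

/-- The monomial `conj u_i * u_j * (conj u_k * u_l)` in the entries `u` of column `z` of `U`. -/
def columnMonomial (z i j k l : n) (U : unitaryGroup n ℂ) : ℂ :=
  star (U.1 i z) * U.1 j z * (star (U.1 k z) * U.1 l z)

theorem columnMonomial_swap_right (z i j k l : n) :
    columnMonomial z i l k j = columnMonomial z i j k l := by
  funext U; simp only [columnMonomial]; ring

theorem columnMonomial_swap_left (z i j k l : n) :
    columnMonomial z k j i l = columnMonomial z i j k l := by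
  funext U; simp only [columnMonomial]; ring

theorem columnMonomial_comm (z i j k l : n) :
    columnMonomial z k l i j = columnMonomial z i j k l := by
  funext U; simp only [columnMonomial]; ring

theorem continuous_columnMonomial (z i j k l : n) : Continuous (columnMonomial z i j k l) := by
  have h (i : n) : Continuous fun U : unitaryGroup n ℂ => U.1 i z :=
    continuous_subtype_val.matrix_elem i z
  exact ((h i).star.mul (h j)).mul ((h k).star.mul (h l))

theorem norm_columnMonomial_le_one (z i j k l : n) (U : unitaryGroup n ℂ) :
    ‖columnMonomial z i j k l U‖ ≤ 1 := by
  have h (i : n) : ‖U.1 i z‖ ≤ 1 := entry_norm_bound_of_unitary U.2 i z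
  simp only [columnMonomial, norm_mul, norm_star]
  exact mul_le_one₀ (mul_le_one₀ (h i) (norm_nonneg _) (h j)) (by positivity)
    (mul_le_one₀ (h k) (norm_nonneg _) (h l))

/-- The quadratic forms of `A` and `B` on column `z`, multiplied out into monomials. -/
theorem conjTranspose_mul_mul_apply_mul (z : n) (A B : Matrix n n ℂ) (U : unitaryGroup n ℂ) :
    (U.1ᴴ * A * U.1) z z * (U.1ᴴ * B * U.1) z z =
      ∑ i, ∑ j, ∑ k, ∑ l, A i j * B k l * columnMonomial z i j k l U := by
  have h (A : Matrix n n ℂ) :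
      (U.1ᴴ * A * U.1) z z = ∑ i, ∑ j, star (U.1 i z) * A i j * U.1 j z := by
    simp only [mul_apply, conjTranspose_apply, Finset.sum_mul]
    exact Finset.sum_comm
  rw [mul_comm]
  simp only [h, Finset.sum_mul, Finset.mul_sum, columnMonomial]
  refine Finset.sum_congr rfl fun i _ => Finset.sum_congr rfl fun j _ =>
    Finset.sum_congr rfl fun k _ => Finset.sum_congr rfl fun l _ => ?_
  ring

theorem sum_columnMonomial (z : n) (U : unitaryGroup n ℂ) :
    ∑ i, ∑ k, columnMonomial z i i k k U = 1 := by
  have h : ∑ i, star (U.1 i z) * U.1 i z = 1 := by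
    have := congrFun (congrFun (mem_unitaryGroup_iff'.1 U.2) z) z
    simpa [mul_apply, star_eq_conjTranspose] using this
  simp only [columnMonomial, ← Finset.mul_sum, h, mul_one]

/-- The diagonal unitary with entry `Complex.I` at `a` and `1` elsewhere. -/
noncomputable def phase (a : n) : unitaryGroup n ℂ :=
  ⟨diagonal fun i => if i = a then Complex.I else 1, by
    rw [mem_unitaryGroup_iff', star_eq_conjTranspose, diagonal_conjTranspose, diagonal_mul_diagonal,
      ← diagonal_one]
    congr 1
    funext i
    by_cases h : i = a <;> simp [h]⟩

theorem phase_mul_apply (a i z : n) (U : unitaryGroup n ℂ) :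
    (phase a * U).1 i z = (if i = a then Complex.I else 1) * U.1 i z := by
  simp [phase, diagonal_mul]

/-- The reflection in the hyperplane orthogonal to `2 e_a - e_b`. -/
noncomputable def reflection {a b : n} (hab : a ≠ b) : unitaryGroup n ℂ :=
  ⟨1 - (2 / 5 : ℂ) • vecMulVec (Pi.single a 2 - Pi.single b 1) (Pi.single a 2 - Pi.single b 1), by
    set v : n → ℂ := Pi.single a 2 - Pi.single b 1 with hv
    have hstar : star v = v := by
      funext i
      simp only [hv, Pi.star_apply, Pi.sub_apply, Pi.single_apply]
      split_ifs <;> simp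
    have hdot : v ⬝ᵥ v = 5 := by
      simp [hv, hab, hab.symm]
      norm_num
    have hself : star (1 - (2 / 5 : ℂ) • vecMulVec v v) = 1 - (2 / 5 : ℂ) • vecMulVec v v := by
      rw [star_eq_conjTranspose, conjTranspose_sub, conjTranspose_smul, conjTranspose_vecMulVec,
        hstar]
      simp
    rw [mem_unitaryGroup_iff', hself]
    have hsq : vecMulVec v v * vecMulVec v v = (5 : ℂ) • vecMulVec v v := by
      rw [vecMulVec_mul_vecMulVec, hdot]
      simp [vecMulVec_smul]
    simp only [sub_mul, mul_sub, one_mul, mul_one, smul_mul_assoc, mul_smul_comm, hsq, smul_smul]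
    module⟩

theorem reflection_mul_apply {a b : n} (hab : a ≠ b) (i z : n) (U : unitaryGroup n ℂ) :
    (reflection hab * U).1 i z = U.1 i z -
      2 / 5 * (Pi.single a 2 - Pi.single b 1 : n → ℂ) i * (2 * U.1 a z - U.1 b z) := by
  simp [reflection, sub_mul, vecMulVec_mul, vecMulVec_apply, sub_vecMul, mul_assoc]

variable [MeasurableSpace (unitaryGroup n ℂ)] [BorelSpace (unitaryGroup n ℂ)]
  (μ : Measure (unitaryGroup n ℂ))

theorem integrable_columnMonomial [IsFiniteMeasure μ] (z i j k l : n) :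
    Integrable (columnMonomial z i j k l) μ :=
  .of_bound (continuous_columnMonomial z i j k l).aestronglyMeasurable 1
    (.of_forall (norm_columnMonomial_le_one z i j k l))

theorem integral_conjTranspose_mul_mul_apply_mul [IsFiniteMeasure μ] (z : n)
    (A B : Matrix n n ℂ) :
    ∫ U : unitaryGroup n ℂ, (U.1ᴴ * A * U.1) z z * (U.1ᴴ * B * U.1) z z ∂μ =
      ∑ i, ∑ j, ∑ k, ∑ l, A i j * B k l * ∫ U, columnMonomial z i j k l U ∂μ := by
  have hint (i j k l : n) : Integrable (fun U => A i j * B k l * columnMonomial z i j k l U) μ :=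
    (integrable_columnMonomial μ z i j k l).const_mul _
  simp only [conjTranspose_mul_mul_apply_mul]
  rw [integral_finsetSum _ fun i _ => by fun_prop]
  refine Finset.sum_congr rfl fun i _ => ?_
  rw [integral_finsetSum _ fun j _ => by fun_prop]
  refine Finset.sum_congr rfl fun j _ => ?_
  rw [integral_finsetSum _ fun k _ => by fun_prop]
  refine Finset.sum_congr rfl fun k _ => ?_
  rw [integral_finsetSum _ fun l _ => by fun_prop]
  exact Finset.sum_congr rfl fun l _ => integral_const_mul _ _

theorem sum_integral_columnMonomial [IsProbabilityMeasure μ] (z : n) :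
    ∑ i, ∑ k, ∫ U, columnMonomial z i i k k U ∂μ = 1 := by
  have hint (i k : n) := integrable_columnMonomial μ z i i k k
  simp only [← integral_finsetSum _ fun k _ => hint _ k]
  rw [← integral_finsetSum _ fun i _ => integrable_finsetSum _ fun k _ => hint i k]
  simp [sum_columnMonomial]

variable [μ.IsMulLeftInvariant]

/-- Monomials that are not balanced at some index `a` integrate to zero. -/
theorem integral_columnMonomial_eq_zero {a z i j k l : n}
    (h : star (if i = a then Complex.I else 1) * (if j = a then Complex.I else 1) *
      (star (if k = a then Complex.I else 1) * (if l = a then Complex.I else 1)) ≠ 1) :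
    ∫ U, columnMonomial z i j k l U ∂μ = 0 := by
  set c := star (if i = a then Complex.I else 1) * (if j = a then Complex.I else 1) *
      (star (if k = a then Complex.I else 1) * (if l = a then Complex.I else 1)) with hc
  have key (U) : columnMonomial z i j k l (phase a * U) = c * columnMonomial z i j k l U := by
    simp only [columnMonomial, phase_mul_apply, star_mul, hc]
    ring
  have hinv := integral_mul_left_eq_self (μ := μ) (columnMonomial z i j k l) (phase a)
  simp only [key, integral_const_mul] at hinv
  have : (c - 1) * ∫ U, columnMonomial z i j k l U ∂μ = 0 := by linear_combination hinv
  exact (mul_eq_zero.1 this).resolve_left (sub_ne_zero.2 h)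

theorem integral_columnMonomial_eq_zero_of_ne {z i j k l : n} (h₁ : ¬(i = j ∧ k = l))
    (h₂ : ¬(i = l ∧ k = j)) : ∫ U, columnMonomial z i j k l U ∂μ = 0 := by
  by_cases hij : i = j
  · subst hij
    have hkl : k ≠ l := fun h => h₁ ⟨rfl, h⟩
    apply integral_columnMonomial_eq_zero μ (a := k)
    by_cases hik : i = k <;> simp [hik, hkl.symm, Complex.ext_iff]
  · by_cases hil : i = l
    · subst hil
      have hkj : k ≠ j := fun h => h₂ ⟨rfl, h⟩
      apply integral_columnMonomial_eq_zero μ (a := k)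
      by_cases hik : i = k <;> simp [hik, hkj.symm, Complex.ext_iff]
    · apply integral_columnMonomial_eq_zero μ (a := i)
      by_cases hki : k = i
      · simp [hki, Ne.symm hij, Ne.symm hil, Complex.ext_iff]
        norm_num
      · simp [hki, Ne.symm hij, Ne.symm hil, Complex.ext_iff]

/-- Fourth moment of a real combination of two entries of a column. -/
theorem integral_star_mul_self_combination [IsFiniteMeasure μ] {a b : n} (hab : a ≠ b) (z : n)
    (s t : ℝ) :
    ∫ U : unitaryGroup n ℂ, star (s * U.1 a z + t * U.1 b z) * (s * U.1 a z + t * U.1 b z) *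
        (star (s * U.1 a z + t * U.1 b z) * (s * U.1 a z + t * U.1 b z)) ∂μ =
      s ^ 4 * ∫ U, columnMonomial z a a a a U ∂μ + t ^ 4 * ∫ U, columnMonomial z b b b b U ∂μ +
        4 * s ^ 2 * t ^ 2 * ∫ U, columnMonomial z a a b b U ∂μ := by
  set r : n → ℂ := Pi.single a (s : ℂ) + Pi.single b (t : ℂ) with hr
  have key (U : unitaryGroup n ℂ) : (U.1ᴴ * vecMulVec r r * U.1) z z =
      star (s * U.1 a z + t * U.1 b z) * (s * U.1 a z + t * U.1 b z) := by
    simp [hr, mul_vecMulVec, vecMulVec_mul, vecMulVec_apply, add_vecMul, mulVec_add]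
  have := integral_conjTranspose_mul_mul_apply_mul μ z (vecMulVec r r) (vecMulVec r r)
  simp only [key] at this
  rw [this]
  have hz {i j k l : n} (h₁ : ¬(i = j ∧ k = l)) (h₂ : ¬(i = l ∧ k = j)) :=
    integral_columnMonomial_eq_zero_of_ne μ (z := z) h₁ h₂
  have hsum (F : n → ℂ) : ∑ i, r i * F i = s * F a + t * F b := by
    simp [hr, add_mul, Finset.sum_add_distrib, Pi.single_apply]
  have hfactor (i j k l : n) :
      vecMulVec r r i j * vecMulVec r r k l * ∫ U, columnMonomial z i j k l U ∂μ =
        r i * (r j * (r k * (r l * ∫ U, columnMonomial z i j k l U ∂μ))) := by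
    simp only [vecMulVec_apply]
    ring
  simp only [hfactor, ← Finset.mul_sum, hsum]
  have hba := hab.symm
  rw [hz (i := a) (j := a) (k := a) (l := b), hz (i := a) (j := a) (k := b) (l := a),
    hz (i := a) (j := b) (k := a) (l := a), hz (i := a) (j := b) (k := a) (l := b),
    hz (i := a) (j := b) (k := b) (l := b), hz (i := b) (j := a) (k := a) (l := a),
    hz (i := b) (j := a) (k := b) (l := a), hz (i := b) (j := a) (k := b) (l := b),
    hz (i := b) (j := b) (k := a) (l := b), hz (i := b) (j := b) (k := b) (l := a),
    columnMonomial_swap_right z a a b b, columnMonomial_swap_left z a a b b,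
    columnMonomial_comm z b b a a]
  · ring
  all_goals simp [hab, hba]

theorem integral_columnMonomial_of_ne [IsFiniteMeasure μ] {a b : n} (hab : a ≠ b) (z : n) :
    ∫ U, columnMonomial z a a a a U ∂μ = ∫ U, columnMonomial z b b b b U ∂μ ∧
      ∫ U, columnMonomial z a a b b U ∂μ = (∫ U, columnMonomial z a a a a U ∂μ) / 2 := by
  have ha := integral_mul_left_eq_self (μ := μ) (columnMonomial z a a a a) (reflection hab)
  have hb := integral_mul_left_eq_self (μ := μ) (columnMonomial z b b b b) (reflection hab)
  have ha' (U : unitaryGroup n ℂ) : (reflection hab * U).1 a z =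
      (-3 / 5 : ℝ) * U.1 a z + (4 / 5 : ℝ) * U.1 b z := by
    rw [reflection_mul_apply]
    simp [hab]
    ring
  have hb' (U : unitaryGroup n ℂ) : (reflection hab * U).1 b z =
      (4 / 5 : ℝ) * U.1 a z + (3 / 5 : ℝ) * U.1 b z := by
    rw [reflection_mul_apply]
    simp [hab.symm]
    ring
  simp only [columnMonomial, ha'] at ha
  simp only [columnMonomial, hb'] at hb
  have ha2 := (integral_star_mul_self_combination μ hab z _ _).symm.trans ha
  have hb2 := (integral_star_mul_self_combination μ hab z _ _).symm.trans hb
  change _ = ∫ U, columnMonomial z a a a a U ∂μ at ha2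
  change _ = ∫ U, columnMonomial z b b b b U ∂μ at hb2
  push_cast at ha2 hb2
  have hX : ∫ U, columnMonomial z a a a a U ∂μ = ∫ U, columnMonomial z b b b b U ∂μ := by
    linear_combination (25 / 32 : ℂ) * (hb2 - ha2)
  refine ⟨hX, ?_⟩
  linear_combination (625 / 576 : ℂ) * ha2 + (256 / 576 : ℂ) * hX

theorem integral_columnMonomial_self_self [IsProbabilityMeasure μ] (z i k : n) :
    ∫ U, columnMonomial z i i k k U ∂μ =
      (1 + if i = k then 1 else 0) / (Fintype.card n * (Fintype.card n + 1)) := by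
  have hdiag (i : n) :
      ∫ U, columnMonomial z i i i i U ∂μ = ∫ U, columnMonomial z z z z z U ∂μ := by
    by_cases h : i = z
    · rw [h]
    · exact (integral_columnMonomial_of_ne μ h z).1
  generalize ∫ U, columnMonomial z z z z z U ∂μ = q at hdiag
  have hall (i k : n) : ∫ U, columnMonomial z i i k k U ∂μ =
      (1 + if i = k then 1 else 0) * (q / 2) := by
    by_cases h : i = k
    · subst h
      rw [hdiag, if_pos rfl]
      ring
    · rw [(integral_columnMonomial_of_ne μ h z).2, hdiag, if_neg h]
      ring
  have hsum := sum_integral_columnMonomial μ z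
  simp only [hall, ← Finset.sum_mul, Finset.sum_add_distrib, Finset.sum_const,
    Finset.sum_ite_eq, Finset.mem_univ, if_true, Finset.card_univ, nsmul_eq_mul, mul_one] at hsum
  have hcard : (Fintype.card n : ℂ) ≠ 0 := by
    have : Nonempty n := ⟨z⟩
    exact_mod_cast Fintype.card_ne_zero
  have hcard' : (Fintype.card n : ℂ) + 1 ≠ 0 := Nat.cast_add_one_ne_zero _
  rw [hall, eq_div_iff (mul_ne_zero hcard hcard')]
  linear_combination (1 + if i = k then 1 else 0) * hsum

theorem integral_columnMonomial [IsProbabilityMeasure μ] (z i j k l : n) :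
    ∫ U, columnMonomial z i j k l U ∂μ =
      ((if i = j then if k = l then 1 else 0 else 0) +
        if i = l then if k = j then 1 else 0 else 0) /
        (Fintype.card n * (Fintype.card n + 1)) := by
  by_cases h₁ : i = j ∧ k = l
  · obtain ⟨rfl, rfl⟩ := h₁
    rw [integral_columnMonomial_self_self]
    by_cases h : i = k <;> simp [h]
  by_cases h₂ : i = l ∧ k = j
  · obtain ⟨rfl, rfl⟩ := h₂
    have hik : i ≠ k := fun h => h₁ ⟨h, h.symm⟩
    rw [← columnMonomial_swap_right, integral_columnMonomial_self_self]
    simp [hik]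
  · rw [integral_columnMonomial_eq_zero_of_ne μ h₁ h₂]
    rw [← ite_and, ← ite_and, if_neg h₁, if_neg h₂]
    simp

theorem integral_conjTranspose_mul_mul_apply_mul_eq_trace [IsProbabilityMeasure μ] (z : n)
    (A B : Matrix n n ℂ) :
    ∫ U : unitaryGroup n ℂ, (U.1ᴴ * A * U.1) z z * (U.1ᴴ * B * U.1) z z ∂μ =
      (trace A * trace B + trace (A * B)) / (Fintype.card n * (Fintype.card n + 1)) := by
  simp only [integral_conjTranspose_mul_mul_apply_mul, integral_columnMonomial, mul_div_assoc',
    ← Finset.sum_div, mul_add, Finset.sum_add_distrib, mul_ite, mul_one, mul_zero]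
  simp [trace, mul_apply, Finset.sum_mul_sum]

end Matrix.unitaryGroup

/-- Second-moment Haar integral formula: for any `d×d` complex matrices
`A`, `B`, `∫ ⟨0|U†AU|0⟩⟨0|U†BU|0⟩ dμ(U) = (tr A · tr B + tr(AB)) / (d(d+1))`. -/
theorem haar_second_moment (d : ℕ) (hd : 1 ≤ d)
    [MeasurableSpace (Matrix.unitaryGroup (Fin d) ℂ)]
    [BorelSpace (Matrix.unitaryGroup (Fin d) ℂ)]
    (μ : Measure (Matrix.unitaryGroup (Fin d) ℂ))
    [μ.IsHaarMeasure] [IsProbabilityMeasure μ]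
    (A B : Matrix (Fin d) (Fin d) ℂ) :
    ∫ U : Matrix.unitaryGroup (Fin d) ℂ,
        (((U : Matrix (Fin d) (Fin d) ℂ)ᴴ * A * (U : Matrix (Fin d) (Fin d) ℂ))
            (⟨0, by omega⟩ : Fin d) (⟨0, by omega⟩ : Fin d)) *
        (((U : Matrix (Fin d) (Fin d) ℂ)ᴴ * B * (U : Matrix (Fin d) (Fin d) ℂ))
            (⟨0, by omega⟩ : Fin d) (⟨0, by omega⟩ : Fin d)) ∂μ
      = (Matrix.trace A * Matrix.trace B + Matrix.trace (A * B)) /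
          ((d : ℂ) * ((d : ℂ) + 1)) := by
  simpa using Matrix.unitaryGroup.integral_conjTranspose_mul_mul_apply_mul_eq_trace μ
    (⟨0, by omega⟩ : Fin d) A B
end
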